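/- arXiv:1603.07779 — 4 statements merged into one kernel-verified Lean document; each statement's English description precedes it below -/
import Mathlib

section
/- For every positive integer k divisible by 9 there exists a total 0-1 matrix M with rank₊(M) = k and rank₀₁(M) = (4/3)·k. -/
/-- `M` is a total 0-1 matrix: every entry is `0` or `1`. -/
def Is01 {α β : Type*} (M : Matrix α β ℝ) : Prop :=
  ∀ i j, M i j = 0 ∨ M i j = 1

/-- `M` is a sum of `r` entrywise-nonnegative rank-at-most-1 real matrices,
the `k`-th summand being the outer product of the nonnegative vectors `u k` and `v k`. -/
def NNDecomp {α β : Type*} (M : Matrix α β ℝ) (r : ℕ) : Prop :=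
  ∃ (u : Fin r → α → ℝ) (v : Fin r → β → ℝ),
    (∀ k i, 0 ≤ u k i) ∧ (∀ k j, 0 ≤ v k j) ∧
    ∀ i j, M i j = ∑ k, u k i * v k j

/-- The nonnegative rank `rank₊(M)`: the smallest `r` such that `M` is a sum of `r`
entrywise-nonnegative rank-at-most-1 real matrices. -/
noncomputable def nnRank {α β : Type*} (M : Matrix α β ℝ) : ℕ :=
  sInf {r | NNDecomp M r}

/-- `M` is a sum of `r` rank-at-most-1 matrices all of whose entries are in `{0,1}`,
the `k`-th summand being the outer product of the 0-1 vectors `u k` and `v k`. -/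
def BinDecomp {α β : Type*} (M : Matrix α β ℝ) (r : ℕ) : Prop :=
  ∃ (u : Fin r → α → ℝ) (v : Fin r → β → ℝ),
    (∀ k i, u k i = 0 ∨ u k i = 1) ∧ (∀ k j, v k j = 0 ∨ v k j = 1) ∧
    ∀ i j, M i j = ∑ k, u k i * v k j

/-- The binary rank `rank₀₁(M)`: the smallest `r` such that `M` is a sum of `r`
rank-at-most-1 matrices with entries in `{0,1}`. -/
noncomputable def binRank {α β : Type*} (M : Matrix α β ℝ) : ℕ :=
  sInf {r | BinDecomp M r}

/-- Rows of the gap matrix: the cells, rows and columns of a `3 × 3` grid. -/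
abbrev GapRow := (Fin 3 × Fin 3) ⊕ (Fin 3 ⊕ Fin 3)

/-- Columns of the gap matrix: `inl (a, b)` is the 4-cycle of `K₃,₃` avoiding row `a` and
column `b`, and `inr c` is the 6-cycle avoiding the perfect matching `i ↦ i + c`. -/
abbrev GapCol := (Fin 3 × Fin 3) ⊕ Fin 3

/-- The support of the gap matrix: incidence of the cells, rows and columns of a `3 × 3` grid
with the cycles in `GapCol`. -/
def gapRel : GapRow → GapCol → Bool
  | .inl (i, j), .inl (a, b) => i ≠ a && j ≠ b
  | .inl (i, j), .inr c => j ≠ i + c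
  | .inr (.inl i), .inl (a, _) => i ≠ a
  | .inr (.inr j), .inl (_, b) => j ≠ b
  | .inr _, .inr _ => true

/-- A partition of the ones of the gap matrix into rectangles indexed by `ι`:
`A ρ` and `B c` are the sets of rectangles meeting row `ρ` and column `c`. -/
def IsGapPartition {ι : Type*} [DecidableEq ι] (A : GapRow → Finset ι) (B : GapCol → Finset ι) :
    Prop :=
  ∀ ρ c, (A ρ ∩ B c).card = if gapRel ρ c then 1 else 0

section Vanishing

variable {ι : Type*} [Fintype ι]

theorem apply_eq_zero_of_finrank_le_one {V : Submodule ℚ (ι → ℚ)}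
    (hV : Module.finrank ℚ V ≤ 1) {v w : ι → ℚ} (hv : v ∈ V) (hw : w ∈ V) (hv0 : v ≠ 0) {k : ι}
    (hk : v k = 0) : w k = 0 := by
  by_contra hwk
  have hli : LinearIndependent ℚ ![v, w] := by
    rw [LinearIndependent.pair_iff' hv0]
    rintro a rfl
    simp [hk] at hwk
  have h1 : Submodule.span ℚ (Set.range ![v, w]) ≤ V := by
    rw [Submodule.span_le, Set.range_subset_iff]
    simp [Fin.forall_fin_two, hv, hw]
  have := Submodule.finrank_mono h1
  rw [finrank_span_eq_card hli] at this
  simp at this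
  omega

theorem apply_eq_zero_of_finrank_le_two {V : Submodule ℚ (ι → ℚ)}
    (hV : Module.finrank ℚ V ≤ 2) {u v w : ι → ℚ} (hu : u ∈ V) (hv : v ∈ V) (hw : w ∈ V)
    (hli : LinearIndependent ℚ ![u, v]) {k : ι} (huk : u k = 0) (hvk : v k = 0) : w k = 0 := by
  by_contra hwk
  have hnot : w ∉ Submodule.span ℚ (Set.range ![u, v]) := by
    have hle : Submodule.span ℚ (Set.range ![u, v]) ≤
        LinearMap.ker (LinearMap.proj k : (ι → ℚ) →ₗ[ℚ] ℚ) := by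
      rw [Submodule.span_le, Set.range_subset_iff]
      simp [Fin.forall_fin_two, huk, hvk]
    exact fun hc => hwk (hle hc)
  have hli3 : LinearIndependent ℚ ![w, u, v] := linearIndependent_finCons.2 ⟨hli, hnot⟩
  have h1 : Submodule.span ℚ (Set.range ![w, u, v]) ≤ V := by
    rw [Submodule.span_le, Set.range_subset_iff]
    simp [Fin.forall_fin_succ, hu, hv, hw]
  have := Submodule.finrank_mono h1
  rw [finrank_span_eq_card hli3] at this
  simp at this
  omega

end Vanishing

/-- Transposing the grid on the rows of the gap matrix. -/
def gapRowSwap : GapRow → GapRow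
  | .inl (i, j) => .inl (j, i)
  | .inr (.inl i) => .inr (.inr i)
  | .inr (.inr j) => .inr (.inl j)

/-- Transposing the grid on the columns of the gap matrix. -/
def gapColSwap : GapCol → GapCol
  | .inl (a, b) => .inl (b, a)
  | .inr c => .inr (-c)

section Partition

variable {ι : Type*} {A : GapRow → Finset ι} {B : GapCol → Finset ι}

/-- Some rectangle contains all four cells of the 4-cycle column `(a, b)`. -/
def HasFull (A : GapRow → Finset ι) (B : GapCol → Finset ι) (a b : Fin 3) : Prop :=
  ∃ k, k ∈ B (.inl (a, b)) ∧ ∀ i j, i ≠ a → j ≠ b → k ∈ A (.inl (i, j))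

theorem HasFull.swap {a b : Fin 3} (h : HasFull A B a b) :
    HasFull (A ∘ gapRowSwap) (B ∘ gapColSwap) b a := by
  obtain ⟨k, hk, h⟩ := h
  exact ⟨k, hk, fun i j hi hj => h j i hj hi⟩

variable [DecidableEq ι]

theorem IsGapPartition.not_mem (h : IsGapPartition A B) {ρ : GapRow} {c : GapCol} {k : ι}
    (hr : gapRel ρ c = false) (hA : k ∈ A ρ) : k ∉ B c := by
  intro hB
  have h1 := h ρ c
  simp only [hr, Bool.false_eq_true, if_false, Finset.card_eq_zero] at h1
  have : k ∈ A ρ ∩ B c := Finset.mem_inter.2 ⟨hA, hB⟩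
  simp [h1] at this

theorem IsGapPartition.exists_mem (h : IsGapPartition A B) {ρ : GapRow} {c : GapCol}
    (hr : gapRel ρ c = true) : ∃ k, k ∈ A ρ ∧ k ∈ B c := by
  have h1 := h ρ c
  rw [if_pos hr, Finset.card_eq_one] at h1
  obtain ⟨k, hk⟩ := h1
  exact ⟨k, Finset.mem_inter.1 (hk ▸ Finset.mem_singleton_self k)⟩

theorem IsGapPartition.unique (h : IsGapPartition A B) {ρ : GapRow} {c : GapCol} {k l : ι}
    (hk : k ∈ A ρ) (hk' : k ∈ B c) (hl : l ∈ A ρ) (hl' : l ∈ B c) : k = l := by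
  have h1 : (A ρ ∩ B c).card ≤ 1 := by rw [h ρ c]; split_ifs <;> simp
  exact Finset.card_le_one.1 h1 k (Finset.mem_inter.2 ⟨hk, hk'⟩) l (Finset.mem_inter.2 ⟨hl, hl'⟩)

theorem gapRel_swap (ρ : GapRow) (c : GapCol) :
    gapRel (gapRowSwap ρ) (gapColSwap c) = gapRel ρ c := by
  revert ρ c; decide

theorem IsGapPartition.swap (h : IsGapPartition A B) :
    IsGapPartition (A ∘ gapRowSwap) (B ∘ gapColSwap) := by
  intro ρ c
  rw [← gapRel_swap]
  exact h _ _

/-- The rational indicator vector of a set of rectangles. -/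
def indVec (s : Finset ι) : ι → ℚ := fun k => if k ∈ s then 1 else 0

/-- The defect of the relation that the cells of row `i` sum to twice row `i`. -/
def rowDefect (A : GapRow → Finset ι) (i : Fin 3) : ι → ℚ :=
  ∑ j, indVec (A (.inl (i, j))) - (2 : ℚ) • indVec (A (.inr (.inl i)))

/-- The defect of the relation that the cells of column `j` sum to twice column `j`. -/
def colDefect (A : GapRow → Finset ι) (j : Fin 3) : ι → ℚ :=
  ∑ i, indVec (A (.inl (i, j))) - (2 : ℚ) • indVec (A (.inr (.inr j)))

theorem rowDefect_apply (i : Fin 3) (k : ι) :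
    rowDefect A i k = ∑ j, (if k ∈ A (.inl (i, j)) then 1 else 0) -
      2 * (if k ∈ A (.inr (.inl i)) then 1 else 0) := by
  simp [rowDefect, indVec, Finset.sum_apply]

theorem colDefect_apply (j : Fin 3) (k : ι) :
    colDefect A j k = ∑ i, (if k ∈ A (.inl (i, j)) then 1 else 0) -
      2 * (if k ∈ A (.inr (.inr j)) then 1 else 0) := by
  simp [colDefect, indVec, Finset.sum_apply]

theorem rowDefect_eq_zero_of_mem (h : IsGapPartition A B) {a b : Fin 3} {k : ι}
    (hk : k ∈ B (.inl (a, b))) : rowDefect A a k = 0 := by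
  have h1 : ∀ j, k ∉ A (.inl (a, j)) := fun j hA => h.not_mem (by simp [gapRel]) hA hk
  have h2 : k ∉ A (.inr (.inl a)) := fun hA => h.not_mem (by simp [gapRel]) hA hk
  simp [rowDefect_apply, h1, h2]

theorem colDefect_eq_zero_of_mem (h : IsGapPartition A B) {a b : Fin 3} {k : ι}
    (hk : k ∈ B (.inl (a, b))) : colDefect A b k = 0 :=
  rowDefect_eq_zero_of_mem (A := A ∘ gapRowSwap) (B := B ∘ gapColSwap) h.swap (a := b) (b := a) hk

/-- A rectangle without column defect contains both or none of two cells in a column,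
if it avoids the third. -/
theorem mem_of_colDefect_eq_zero {i i' a j : Fin 3} {k : ι} (hd : colDefect A j k = 0)
    (ha : k ∉ A (.inl (a, j))) (hi : k ∈ A (.inl (i, j))) (hi' : i' ≠ a) :
    k ∈ A (.inl (i', j)) := by
  rw [colDefect_apply, Fin.sum_univ_three] at hd
  by_contra hc
  have hia : i ≠ a := by rintro rfl; exact ha hi
  have hii : i ≠ i' := by rintro rfl; exact hc hi
  have key : (∑ i, if k ∈ A (.inl (i, j)) then (1 : ℚ) else 0) = 1 := by
    rw [Finset.sum_eq_single i]
    · simp [hi]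
    · intro l _ hl
      have : l = a ∨ l = i' := by omega
      rcases this with rfl | rfl <;> simp [ha, hc]
    · simp
  rw [Fin.sum_univ_three] at key
  rw [key] at hd
  split_ifs at hd <;> norm_num at hd

theorem mem_of_rowDefect_eq_zero {i j j' b : Fin 3} {k : ι} (hd : rowDefect A i k = 0)
    (hb : k ∉ A (.inl (i, b))) (hj : k ∈ A (.inl (i, j))) (hj' : j' ≠ b) :
    k ∈ A (.inl (i, j')) :=
  mem_of_colDefect_eq_zero (A := A ∘ gapRowSwap) (i := j) (i' := j') (a := b) (j := i) hd hb hj hj'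

theorem not_mem_cell_left (h : IsGapPartition A B) {a b j : Fin 3} {k : ι}
    (hk : k ∈ B (.inl (a, b))) : k ∉ A (.inl (a, j)) :=
  fun hA => h.not_mem (by simp [gapRel]) hA hk

theorem not_mem_cell_right (h : IsGapPartition A B) {a b i : Fin 3} {k : ι}
    (hk : k ∈ B (.inl (a, b))) : k ∉ A (.inl (i, b)) :=
  fun hA => h.not_mem (by simp [gapRel]) hA hk

theorem hasFull_of_defect_eq_zero (h : IsGapPartition A B) {a b : Fin 3}
    (hr : ∀ k ∈ B (.inl (a, b)), ∀ i, rowDefect A i k = 0)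
    (hc : ∀ k ∈ B (.inl (a, b)), ∀ j, colDefect A j k = 0) : HasFull A B a b := by
  obtain ⟨k, hk, hkB⟩ := h.exists_mem (ρ := .inl (a + 1, b + 1)) (c := .inl (a, b))
    (by simp [gapRel])
  refine ⟨k, hkB, fun i j hi hj => ?_⟩
  have h1 := mem_of_rowDefect_eq_zero (hr k hkB _) (not_mem_cell_right h hkB) hk hj
  exact mem_of_colDefect_eq_zero (hc k hkB _) (not_mem_cell_left h hkB) h1 hi

/-- The linear map sending a weighting of the rectangles to the induced weighted sum of
their column indicators. -/
def colMap (B : GapCol → Finset ι) : (ι → ℚ) →ₗ[ℚ] (GapCol → ℚ) :=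
  LinearMap.pi fun c => ∑ k ∈ B c, LinearMap.proj k

theorem colMap_indVec (h : IsGapPartition A B) (ρ : GapRow) (c : GapCol) :
    colMap B (indVec (A ρ)) c = if gapRel ρ c then 1 else 0 := by
  have : ((A ρ ∩ B c).card : ℚ) = if gapRel ρ c then 1 else 0 := by
    rw [h ρ c]; split_ifs <;> simp
  rw [← this]
  simp [colMap, indVec, Finset.inter_comm]

theorem rowDefect_mem_ker (h : IsGapPartition A B) (i : Fin 3) :
    rowDefect A i ∈ LinearMap.ker (colMap B) := by
  rw [LinearMap.mem_ker]
  ext c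
  simp only [rowDefect, map_sub, map_sum, map_smul, Pi.sub_apply, Finset.sum_apply, Pi.smul_apply,
    colMap_indVec h, Pi.zero_apply, smul_eq_mul]
  rcases c with ⟨a, b⟩ | c
  · by_cases hi : i = a
    · simp [gapRel, hi]
    · fin_cases b <;> simp [gapRel, hi, Fin.sum_univ_three] <;> norm_num
  · fin_cases i <;> fin_cases c <;> simp [gapRel, Fin.sum_univ_three] <;> norm_num

theorem colDefect_mem_ker (h : IsGapPartition A B) (j : Fin 3) :
    colDefect A j ∈ LinearMap.ker (colMap B) := by
  rw [LinearMap.mem_ker]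
  ext c
  simp only [colDefect, map_sub, map_sum, map_smul, Pi.sub_apply, Finset.sum_apply, Pi.smul_apply,
    colMap_indVec h, Pi.zero_apply, smul_eq_mul]
  rcases c with ⟨a, b⟩ | c
  · by_cases hj : j = b
    · simp [gapRel, hj]
    · fin_cases a <;> simp [gapRel, hj, Fin.sum_univ_three] <;> norm_num
  · fin_cases j <;> fin_cases c <;> simp [gapRel, Fin.sum_univ_three] <;> norm_num

/-- The basis of the row space of the gap matrix dual to the 4-cycle columns. -/
def dualRow (p : Fin 3 × Fin 3) : GapCol → ℚ
  | .inl q => if p = q then 1 else 0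
  | .inr c => if p.2 = p.1 + c then -1 / 2 else 1 / 2

theorem dualRow_mem_range (h : IsGapPartition A B) (p : Fin 3 × Fin 3) :
    dualRow p ∈ LinearMap.range (colMap B) := by
  refine ⟨∑ a, ∑ b, ((if p.1 = a then -1 / 2 else 1 / 2) *
    (if p.2 = b then -1 / 2 else 1 / 2) : ℚ) • indVec (A (.inl (a, b))), ?_⟩
  ext c
  simp only [map_sum, map_smul, Finset.sum_apply, Pi.smul_apply, colMap_indVec h, smul_eq_mul]
  obtain ⟨i, j⟩ := p
  rcases c with ⟨a, b⟩ | c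
  · fin_cases i <;> fin_cases j <;> fin_cases a <;> fin_cases b <;>
      simp [dualRow, gapRel, Fin.sum_univ_three] <;> norm_num
  · fin_cases i <;> fin_cases j <;> fin_cases c <;>
      simp [dualRow, gapRel, Fin.sum_univ_three] <;> norm_num

theorem single_mem_range (h : IsGapPartition A B) {a b : Fin 3} (hf : HasFull A B a b) :
    Pi.single (.inl (a, b)) 1 ∈ LinearMap.range (colMap B) := by
  obtain ⟨k, hkB, hk⟩ := hf
  refine ⟨Pi.single k 1, ?_⟩
  ext c
  have key : ∀ (a b : Fin 3) (c : GapCol), c ≠ .inl (a, b) →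
      ∃ i j, i ≠ a ∧ j ≠ b ∧ gapRel (.inl (i, j)) c = false := by decide
  by_cases hc : c = .inl (a, b)
  · subst hc
    simp [colMap, Pi.single_apply, hkB]
  · obtain ⟨i, j, hi, hj, hr⟩ := key a b c hc
    have := h.not_mem hr (hk i j hi hj)
    simp [colMap, Pi.single_apply, this, hc]

theorem linearIndependent_dualRow (a : Fin 3) :
    LinearIndependent ℚ (Sum.elim dualRow
      fun b : Fin 3 => dualRow (a, b) - Pi.single (.inl (a, b)) 1) := by
  rw [Fintype.linearIndependent_iff]
  intro g hg
  have h1 : ∀ p, g (.inl p) = 0 := by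
    intro p
    have := congrFun hg (.inl p)
    simpa [Fintype.sum_sum_type, dualRow, Pi.single_apply, eq_comm] using this
  have h2 : ∀ c, ∑ b, g (.inr b) * (if b = a + c then -1 / 2 else 1 / 2) = 0 := by
    intro c
    have := congrFun hg (.inr c)
    simpa [Fintype.sum_sum_type, dualRow, h1] using this
  have h3 : ∀ b, g (.inr b) = 0 := by
    have e0 := h2 0
    have e1 := h2 1
    have e2 := h2 2
    simp only [Fin.sum_univ_three] at e0 e1 e2
    intro b
    fin_cases a <;> fin_cases b <;> simp at e0 e1 e2 ⊢ <;> linarith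
  rintro (p | b)
  exacts [h1 p, h3 b]

/-- In the absence of column defects, a rectangle containing a cell of the 4-cycle column `(a, b)`
contains the other cell in the same grid column. -/
theorem mem_cell_of_mem_cell (h : IsGapPartition A B) (hc : ∀ j, colDefect A j = 0)
    {a b i i' j : Fin 3} {k : ι} (hk : k ∈ B (.inl (a, b))) (hi : k ∈ A (.inl (i, j)))
    (hi' : i' ≠ a) : k ∈ A (.inl (i', j)) :=
  mem_of_colDefect_eq_zero (by simp [hc j]) (not_mem_cell_left h hk) hi hi'

theorem eq_of_mem_cell (h : IsGapPartition A B) (hf : ∀ a b, ¬ HasFull A B a b)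
    (hc : ∀ j, colDefect A j = 0) {a b i i' j j' : Fin 3} {k : ι} (hk : k ∈ B (.inl (a, b)))
    (hi : k ∈ A (.inl (i, j))) (hi' : k ∈ A (.inl (i', j'))) : j = j' := by
  by_contra hne
  refine hf a b ⟨k, hk, fun l m hl hm => ?_⟩
  have hjb : j ≠ b := by rintro rfl; exact not_mem_cell_right h hk hi
  have hjb' : j' ≠ b := by rintro rfl; exact not_mem_cell_right h hk hi'
  have : m = j ∨ m = j' := by omega
  rcases this with rfl | rfl
  exacts [mem_cell_of_mem_cell h hc hk hi hl, mem_cell_of_mem_cell h hc hk hi' hl]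

theorem rowDefect_of_mem_cell (h : IsGapPartition A B) (hf : ∀ a b, ¬ HasFull A B a b)
    (hc : ∀ j, colDefect A j = 0) {a b i j : Fin 3} {k : ι} (hk : k ∈ B (.inl (a, b)))
    (hi : k ∈ A (.inl (i, j))) :
    rowDefect A i k = 1 - 2 * (if k ∈ A (.inr (.inl i)) then 1 else 0) := by
  rw [rowDefect_apply, Finset.sum_eq_single j]
  · simp [hi]
  · intro l _ hl
    exact if_neg fun hA => hl (eq_of_mem_cell h hf hc hk hA hi)
  · simp

theorem sum_fin_three {i i' a : Fin 3} (hi : i ≠ a) (hi' : i' ≠ a) (hii : i ≠ i') (f : Fin 3 → ℚ) :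
    ∑ x, f x = f i + f i' + f a := by
  have : (Finset.univ : Finset (Fin 3)) = {i, i', a} := by
    revert i i' a; decide
  rw [this, Finset.sum_insert (by simp [hi, hii]), Finset.sum_insert (by simp [hi']),
    Finset.sum_singleton, add_assoc]

theorem coeff_relation (h : IsGapPartition A B) {n : Fin 3 → ℚ}
    (hn : ∀ k, ∑ i, n i * rowDefect A i k = 0) {a b i i' : Fin 3} {k : ι}
    (hk : k ∈ B (.inl (a, b))) (hi : i ≠ a) (hi' : i' ≠ a) (hii : i ≠ i') :
    n i * rowDefect A i k + n i' * rowDefect A i' k = 0 := by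
  have := hn k
  rwa [sum_fin_three hi hi' hii, rowDefect_eq_zero_of_mem h hk, mul_zero, add_zero] at this

theorem coeff_ne_zero (h : IsGapPartition A B) (hf : ∀ a b, ¬ HasFull A B a b)
    (hc : ∀ j, colDefect A j = 0) {n : Fin 3 → ℚ} (hn0 : n ≠ 0)
    (hn : ∀ k, ∑ i, n i * rowDefect A i k = 0) (i : Fin 3) : n i ≠ 0 := by
  intro hi0
  refine hn0 (funext fun i' => ?_)
  by_cases hii : i = i'
  · exact hii ▸ hi0
  obtain ⟨a, hi, hi'⟩ : ∃ a, i ≠ a ∧ i' ≠ a := by clear hi0; revert i i'; decide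
  obtain ⟨k, hkA, hkB⟩ := h.exists_mem (ρ := .inl (i', 1)) (c := .inl (a, 0))
    (by simp [gapRel, hi'])
  have := coeff_relation h hn hkB hi hi' hii
  rw [hi0, zero_mul, zero_add, rowDefect_of_mem_cell h hf hc hkB hkA, mul_eq_zero] at this
  refine this.resolve_right ?_
  split_ifs <;> norm_num

variable [Fintype ι]

theorem finrank_ker_add_le (h : IsGapPartition A B) (a : Fin 3) (s : Finset (Fin 3))
    (hs : ∀ b ∈ s, HasFull A B a b) :
    Module.finrank ℚ (LinearMap.ker (colMap B)) + (9 + s.card) ≤ Fintype.card ι := by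
  have hli := (linearIndependent_dualRow a).comp
    (Sum.map id (Subtype.val : s → Fin 3)) (Sum.map_injective.2
      ⟨Function.injective_id, Subtype.val_injective⟩)
  have hle : 9 + s.card ≤ Module.finrank ℚ (LinearMap.range (colMap B)) := by
    have hmem : ∀ x, (Sum.elim dualRow (fun b : Fin 3 => dualRow (a, b) -
        Pi.single (.inl (a, b)) 1) ∘ Sum.map id (Subtype.val : s → Fin 3)) x ∈
          LinearMap.range (colMap B) := by
      rintro (p | b)
      · exact dualRow_mem_range h p
      · exact Submodule.sub_mem _ (dualRow_mem_range h _) (single_mem_range h (hs b b.2))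
    have hspan := finrank_span_eq_card hli
    have := Submodule.finrank_mono (Submodule.span_le.2 (Set.range_subset_iff.2 hmem))
    rw [hspan] at this
    simpa using this
  have := LinearMap.finrank_range_add_finrank_ker (colMap B)
  rw [Module.finrank_fintype_fun_eq_card] at this
  omega

theorem not_forall_hasFull (h : IsGapPartition A B) (hι : Fintype.card ι ≤ 11) (a : Fin 3) :
    ¬ ∀ b, HasFull A B a b := by
  intro hf
  have := finrank_ker_add_le h a Finset.univ fun b _ => hf b
  simp at this
  omega

theorem not_hasFull (h : IsGapPartition A B) (hι : Fintype.card ι ≤ 11) (a b : Fin 3) :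
    ¬ HasFull A B a b := by
  intro hf
  have hK : Module.finrank ℚ (LinearMap.ker (colMap B)) ≤ 1 := by
    have := finrank_ker_add_le h a {b} (by simpa using hf)
    simp at this
    omega
  have hr : ∀ i, rowDefect A i = 0 := by
    intro i
    by_contra hi
    refine not_forall_hasFull h hι i fun j => hasFull_of_defect_eq_zero h ?_ ?_
    · exact fun k hk i' => apply_eq_zero_of_finrank_le_one hK (rowDefect_mem_ker h i)
        (rowDefect_mem_ker h i') hi (rowDefect_eq_zero_of_mem h hk)
    · exact fun k hk j' => apply_eq_zero_of_finrank_le_one hK (rowDefect_mem_ker h i)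
        (colDefect_mem_ker h j') hi (rowDefect_eq_zero_of_mem h hk)
  have hc : ∀ j, colDefect A j = 0 := by
    intro j
    by_contra hj
    refine not_forall_hasFull h.swap hι j fun i => HasFull.swap
      (hasFull_of_defect_eq_zero h (fun k hk i' => by simp [hr i']) ?_)
    exact fun k hk j' => apply_eq_zero_of_finrank_le_one hK (colDefect_mem_ker h j)
        (colDefect_mem_ker h j') hj (colDefect_eq_zero_of_mem h hk)
  exact not_forall_hasFull h hι 0 fun j =>
    hasFull_of_defect_eq_zero h (fun k _ i => by simp [hr i]) fun k _ j => by simp [hc j]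

theorem finrank_ker_le_two (h : IsGapPartition A B) (hι : Fintype.card ι ≤ 11) :
    Module.finrank ℚ (LinearMap.ker (colMap B)) ≤ 2 := by
  have := finrank_ker_add_le h 0 ∅ (by simp)
  simp at this
  omega

theorem defect_eq_zero_or (h : IsGapPartition A B) (hι : Fintype.card ι ≤ 11) :
    (∀ i, rowDefect A i = 0) ∨ ∀ j, colDefect A j = 0 := by
  by_contra! hne
  obtain ⟨⟨i, hi⟩, j, hj⟩ := hne
  have hprop : ∀ i j, rowDefect A i ≠ 0 → ∃ a : ℚ, a • rowDefect A i = colDefect A j := by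
    intro i j hi
    by_contra! hcon
    have hli := (LinearIndependent.pair_iff' hi).2 hcon
    refine not_hasFull h hι i j (hasFull_of_defect_eq_zero h ?_ ?_)
    · exact fun k hk i' => apply_eq_zero_of_finrank_le_two (finrank_ker_le_two h hι)
        (rowDefect_mem_ker h i) (colDefect_mem_ker h j) (rowDefect_mem_ker h i') hli
        (rowDefect_eq_zero_of_mem h hk) (colDefect_eq_zero_of_mem h hk)
    · exact fun k hk j' => apply_eq_zero_of_finrank_le_two (finrank_ker_le_two h hι)
        (rowDefect_mem_ker h i) (colDefect_mem_ker h j) (colDefect_mem_ker h j') hli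
        (rowDefect_eq_zero_of_mem h hk) (colDefect_eq_zero_of_mem h hk)
  refine not_hasFull h hι i j (hasFull_of_defect_eq_zero h ?_ ?_)
  · intro k hk i'
    by_cases hi' : rowDefect A i' = 0
    · simp [hi']
    · obtain ⟨a, ha⟩ := hprop i' j hi'
      have ha0 : a ≠ 0 := by rintro rfl; exact hj (by simp [← ha])
      have := congrFun ha k
      rw [colDefect_eq_zero_of_mem h hk] at this
      simpa [ha0] using this
  · intro k hk j'
    obtain ⟨a, ha⟩ := hprop i j' hi
    simp [← ha, rowDefect_eq_zero_of_mem h hk]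

theorem exists_coeff (h : IsGapPartition A B) (hι : Fintype.card ι ≤ 11) :
    ∃ n : Fin 3 → ℚ, n ≠ 0 ∧ ∀ k, ∑ i, n i * rowDefect A i k = 0 := by
  have hnot : ¬ LinearIndependent ℚ (rowDefect A) := by
    intro hli
    have h1 : Submodule.span ℚ (Set.range (rowDefect A)) ≤ LinearMap.ker (colMap B) := by
      rw [Submodule.span_le, Set.range_subset_iff]
      exact rowDefect_mem_ker h
    have h2 := Submodule.finrank_mono h1
    have h3 := finrank_ker_le_two h hι
    rw [finrank_span_eq_card hli, Fintype.card_fin] at h2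
    omega
  rw [Fintype.not_linearIndependent_iff] at hnot
  obtain ⟨n, hn, i, hi⟩ := hnot
  refine ⟨n, fun h0 => hi (by simp [h0]), fun k => ?_⟩
  simpa [Finset.sum_apply] using congrFun hn k

/-- The rectangles meeting some 4-cycle column `(a, b)` and touching both grid rows other
than `a`. -/
def cycleClass (A : GapRow → Finset ι) (B : GapCol → Finset ι) (a : Fin 3) : Finset ι :=
  {k | (∃ b, k ∈ B (.inl (a, b))) ∧
    ∀ i, i ≠ a → k ∈ A (.inr (.inl i)) ∨ ∃ j, k ∈ A (.inl (i, j))}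

theorem disjoint_cycleClass (h : IsGapPartition A B) {a a' : Fin 3} (ha : a ≠ a') :
    Disjoint (cycleClass A B a) (cycleClass A B a') := by
  rw [Finset.disjoint_left]
  intro k hk hk'
  simp only [cycleClass, Finset.mem_filter, Finset.mem_univ, true_and] at hk hk'
  obtain ⟨b, hb⟩ := hk.1
  rcases hk'.2 a ha with hA | ⟨j, hA⟩
  · exact h.not_mem (by simp [gapRel]) hA hb
  · exact not_mem_cell_left h hb hA

theorem mem_cycleClass_of_mem_cell (h : IsGapPartition A B) (hc : ∀ j, colDefect A j = 0)
    {a b i j : Fin 3} {k : ι} (hk : k ∈ B (.inl (a, b))) (hi : k ∈ A (.inl (i, j))) :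
    k ∈ cycleClass A B a := by
  simp only [cycleClass, Finset.mem_filter, Finset.mem_univ, true_and]
  exact ⟨⟨b, hk⟩, fun i' hi' => Or.inr ⟨j, mem_cell_of_mem_cell h hc hk hi hi'⟩⟩

theorem mem_cycleClass_of_mem_row (h : IsGapPartition A B) (hc : ∀ j, colDefect A j = 0)
    {n : Fin 3 → ℚ} (hn0 : ∀ i, n i ≠ 0) (hn : ∀ k, ∑ i, n i * rowDefect A i k = 0)
    {a b i : Fin 3} {k : ι} (hk : k ∈ B (.inl (a, b))) (hia : i ≠ a)
    (hi : k ∈ A (.inr (.inl i))) : k ∈ cycleClass A B a := by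
  by_cases hcell : ∃ i' j, k ∈ A (.inl (i', j))
  · obtain ⟨i', j, hA⟩ := hcell
    exact mem_cycleClass_of_mem_cell h hc hk hA
  push Not at hcell
  simp only [cycleClass, Finset.mem_filter, Finset.mem_univ, true_and]
  refine ⟨⟨b, hk⟩, fun i' hi' => Or.inl ?_⟩
  by_cases hii : i = i'
  · exact hii ▸ hi
  by_contra hnot
  have := coeff_relation h hn hk hia hi' hii
  simp [rowDefect_apply, hcell, hi, hnot, hn0] at this

theorem four_le_card_cycleClass (h : IsGapPartition A B) (hf : ∀ a b, ¬ HasFull A B a b)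
    (hc : ∀ j, colDefect A j = 0) {n : Fin 3 → ℚ} (hn0 : ∀ i, n i ≠ 0)
    (hn : ∀ k, ∑ i, n i * rowDefect A i k = 0) (a : Fin 3) : 4 ≤ (cycleClass A B a).card := by
  by_contra! hlt
  obtain ⟨i, hia⟩ : ∃ i, i ≠ a := exists_ne a
  have hex : ∀ j, ∃ k, k ∈ A (.inl (i, j)) ∧ k ∈ B (.inl (a, j + 1)) := fun j =>
    h.exists_mem (by simp [gapRel, hia])
  choose κ hκA hκB using hex
  have hmem : ∀ j, κ j ∈ cycleClass A B a := fun j =>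
    mem_cycleClass_of_mem_cell h hc (hκB j) (hκA j)
  have hinj : Function.Injective κ := fun j j' hjj =>
    eq_of_mem_cell h hf hc (hκB j) (hκA j) (hjj ▸ hκA j')
  have himg : Finset.univ.image κ = cycleClass A B a := by
    apply Finset.eq_of_subset_of_card_le
    · intro k hk
      obtain ⟨j, _, rfl⟩ := Finset.mem_image.1 hk
      exact hmem j
    · rw [Finset.card_image_of_injective _ hinj, Finset.card_fin]
      omega
  have hsurj : ∀ k ∈ cycleClass A B a, ∃ j, k = κ j := by
    intro k hk
    rw [← himg, Finset.mem_image] at hk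
    obtain ⟨j, _, rfl⟩ := hk
    exact ⟨j, rfl⟩
  have hκB' : ∀ j b, j ≠ b → κ j ∈ B (.inl (a, b)) := by
    intro j b hjb
    obtain ⟨k, hkA, hkB⟩ := h.exists_mem (ρ := .inl (i, j)) (c := .inl (a, b))
      (by simp [gapRel, hia, hjb])
    obtain ⟨l, rfl⟩ := hsurj k (mem_cycleClass_of_mem_cell h hc hkB hkA)
    obtain rfl := eq_of_mem_cell h hf hc (hκB l) (hκA l) hkA
    exact hkB
  have hone : ∀ b, ∃ l, l ≠ b ∧ κ l ∈ A (.inr (.inl i)) ∧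
      ∀ m, m ≠ b → κ m ∈ A (.inr (.inl i)) → m = l := by
    intro b
    obtain ⟨k, hkA, hkB⟩ := h.exists_mem (ρ := .inr (.inl i)) (c := .inl (a, b))
      (by simp [gapRel, hia])
    obtain ⟨l, rfl⟩ := hsurj k (mem_cycleClass_of_mem_row h hc hn0 hn hkB hia hkA)
    refine ⟨l, ?_, hkA, fun m hm hmA => hinj (h.unique hmA (hκB' m b hm) hkA hkB)⟩
    rintro rfl
    exact not_mem_cell_right h hkB (hκA l)
  have hparity : ∀ p : Fin 3 → Bool,
      ¬ ∀ b, ∃ l, l ≠ b ∧ p l = true ∧ ∀ m, m ≠ b → p m = true → m = l := by decide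
  exact hparity (fun l => decide (κ l ∈ A (.inr (.inl i)))) (by simpa using hone)

theorem not_colDefect_eq_zero (h : IsGapPartition A B) (hι : Fintype.card ι ≤ 11) :
    ¬ ∀ j, colDefect A j = 0 := by
  intro hc
  have hf := not_hasFull h hι
  obtain ⟨n, hn0, hn⟩ := exists_coeff h hι
  have hn0' := coeff_ne_zero h hf hc hn0 hn
  have hdisj : ((Finset.univ : Finset (Fin 3)) : Set (Fin 3)).PairwiseDisjoint
      (cycleClass A B) := fun a _ a' _ haa => disjoint_cycleClass h haa
  have hle := Finset.card_le_univ (Finset.univ.biUnion (cycleClass A B))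
  rw [Finset.card_biUnion hdisj, Fin.sum_univ_three] at hle
  have := four_le_card_cycleClass h hf hc hn0' hn
  have h0 := this 0
  have h1 := this 1
  have h2 := this 2
  omega

theorem twelve_le_card (h : IsGapPartition A B) : 12 ≤ Fintype.card ι := by
  by_contra! hlt
  have hι : Fintype.card ι ≤ 11 := by omega
  rcases defect_eq_zero_or h hι with hr | hc
  · exact not_colDefect_eq_zero h.swap hι hr
  · exact not_colDefect_eq_zero h hι hc

end Partition

/-- The block diagonal matrix with `q` copies of the gap matrix as blocks. -/
def gapMatrix (q : ℕ) : Matrix (Fin q × GapRow) (Fin q × GapCol) ℝ :=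
  fun x y => if x.1 = y.1 ∧ gapRel x.2 y.2 then 1 else 0

theorem IsGapPartition.twelve_le_card_inter {ι : Type*} [Fintype ι] [DecidableEq ι]
    {A : GapRow → Finset ι} {B : GapCol → Finset ι} (h : IsGapPartition A B) :
    12 ≤ (Finset.univ.biUnion A ∩ Finset.univ.biUnion B).card := by
  set K := Finset.univ.biUnion A ∩ Finset.univ.biUnion B with hK
  have hsub : IsGapPartition (fun ρ => (A ρ).subtype (· ∈ K)) fun c => (B c).subtype (· ∈ K) := by
    intro ρ c
    have hinter : (A ρ).subtype (· ∈ K) ∩ (B c).subtype (· ∈ K) =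
        (A ρ ∩ B c).subtype (· ∈ K) := by
      ext k
      simp
    rw [← h ρ c, hinter, Finset.card_subtype, Finset.filter_true_of_mem]
    intro k hk
    rw [Finset.mem_inter] at hk
    simp only [hK, Finset.mem_inter, Finset.mem_biUnion, Finset.mem_univ, true_and]
    exact ⟨⟨ρ, hk.1⟩, c, hk.2⟩
  simpa using twelve_le_card hsub

theorem BinDecomp.twelve_mul_le {q r : ℕ} (h : BinDecomp (gapMatrix q) r) : 12 * q ≤ r := by
  obtain ⟨u, v, hu, hv, huv⟩ := h
  let A : Fin q → GapRow → Finset (Fin r) := fun b ρ => {k | u k (b, ρ) = 1}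
  let B : Fin q → GapCol → Finset (Fin r) := fun b c => {k | v k (b, c) = 1}
  have hcard : ∀ b ρ b' c, ((A b ρ ∩ B b' c).card : ℝ) = gapMatrix q (b, ρ) (b', c) := by
    intro b ρ b' c
    rw [huv, ← Finset.filter_and, Finset.natCast_card_filter]
    refine Finset.sum_congr rfl fun k _ => ?_
    rcases hu k (b, ρ) with h1 | h1 <;> rcases hv k (b', c) with h2 | h2 <;> simp [h1, h2]
  have hpart : ∀ b, IsGapPartition (A b) (B b) := by
    intro b ρ c
    have := hcard b ρ b c
    simp only [gapMatrix, true_and] at this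
    exact_mod_cast this
  let K : Fin q → Finset (Fin r) := fun b => Finset.univ.biUnion (A b) ∩ Finset.univ.biUnion (B b)
  have hdisj : ((Finset.univ : Finset (Fin q)) : Set (Fin q)).PairwiseDisjoint K := by
    intro b _ b' _ hbb
    change Disjoint (K b) (K b')
    rw [Finset.disjoint_left]
    intro k hk hk'
    simp only [K, Finset.mem_inter, Finset.mem_biUnion, Finset.mem_univ, true_and] at hk hk'
    obtain ⟨ρ, hρ⟩ := hk.1
    obtain ⟨c, hc⟩ := hk'.2
    have := hcard b ρ b' c
    rw [gapMatrix, if_neg (by simp [hbb])] at this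
    have hmem : k ∈ A b ρ ∩ B b' c := Finset.mem_inter.2 ⟨hρ, hc⟩
    rw [Nat.cast_eq_zero, Finset.card_eq_zero] at this
    simp [this] at hmem
  have hle := Finset.card_le_univ (Finset.univ.biUnion K)
  rw [Finset.card_biUnion hdisj, Fintype.card_fin] at hle
  have hsum := Finset.card_nsmul_le_sum Finset.univ (fun b => (K b).card) 12
    fun b _ => (hpart b).twelve_le_card_inter
  simp at hsum
  omega

theorem binDecomp_of_is01 {α : Type*} {m : ℕ} {M : Matrix α (Fin m) ℝ} (h : Is01 M) :
    BinDecomp M m := by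
  refine ⟨fun k i => M i k, fun k j => if k = j then 1 else 0, fun k i => h i k, fun k j => ?_,
    fun i j => by simp⟩
  by_cases hkj : k = j <;> simp [hkj]

theorem NNDecomp.of_fintype {α β κ : Type*} [Fintype κ] {M : Matrix α β ℝ} (u : κ → α → ℝ)
    (v : κ → β → ℝ) (hu : ∀ k i, 0 ≤ u k i) (hv : ∀ k j, 0 ≤ v k j)
    (huv : ∀ i j, M i j = ∑ k, u k i * v k j) : NNDecomp M (Fintype.card κ) := by
  let e := (Fintype.equivFin κ).symm
  refine ⟨fun k => u (e k), fun k => v (e k), fun k => hu _, fun k => hv _, fun i j => ?_⟩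
  rw [huv, ← e.sum_comp]

/-- Half-integral coefficients expressing the rows of the gap matrix through its cell rows. -/
noncomputable def gapCoeff (p : Fin 3 × Fin 3) : GapRow → ℝ
  | .inl p' => if p = p' then 1 else 0
  | .inr (.inl i) => if p.1 = i then 1 / 2 else 0
  | .inr (.inr j) => if p.2 = j then 1 / 2 else 0

theorem gapCoeff_nonneg (p : Fin 3 × Fin 3) (ρ : GapRow) : 0 ≤ gapCoeff p ρ := by
  rcases ρ with p' | i | j <;> simp only [gapCoeff] <;> split_ifs <;> norm_num

theorem sum_gapCoeff (ρ : GapRow) (c : GapCol) :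
    ∑ p, gapCoeff p ρ * (if gapRel (.inl p) c then 1 else 0) =
      if gapRel ρ c then (1 : ℝ) else 0 := by
  rcases ρ with p | i | j
  · simp only [gapCoeff, ite_mul, one_mul, zero_mul, Finset.sum_ite_eq', Finset.mem_univ, if_true]
  · rw [Fintype.sum_prod_type]
    rcases c with ⟨a, b⟩ | c
    · fin_cases i <;> fin_cases a <;> fin_cases b <;>
        simp [gapCoeff, gapRel, Fin.sum_univ_three] <;> norm_num
    · fin_cases i <;> fin_cases c <;> simp [gapCoeff, gapRel, Fin.sum_univ_three] <;> norm_num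
  · rw [Fintype.sum_prod_type]
    rcases c with ⟨a, b⟩ | c
    · fin_cases j <;> fin_cases a <;> fin_cases b <;>
        simp [gapCoeff, gapRel, Fin.sum_univ_three] <;> norm_num
    · fin_cases j <;> fin_cases c <;> simp [gapCoeff, gapRel, Fin.sum_univ_three] <;> norm_num

theorem nnDecomp_gapMatrix (q : ℕ) : NNDecomp (gapMatrix q) (9 * q) := by
  have := NNDecomp.of_fintype (M := gapMatrix q) (κ := Fin q × (Fin 3 × Fin 3))
    (fun k x => if k.1 = x.1 then gapCoeff k.2 x.2 else 0)
    (fun k y => if k.1 = y.1 ∧ gapRel (.inl k.2) y.2 then 1 else 0)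
    (fun k x => by split_ifs; exacts [gapCoeff_nonneg _ _, le_rfl])
    (fun k y => by split_ifs <;> norm_num) ?_
  · simpa [mul_comm] using this
  · rintro ⟨b, ρ⟩ ⟨b', c⟩
    rw [Fintype.sum_prod_type, Finset.sum_eq_single b]
    · by_cases hb : b = b'
      · simp [gapMatrix, hb, ← sum_gapCoeff ρ c]
      · simp [gapMatrix, hb]
    · intro b'' _ hb
      simp [hb]
    · simp

/-- The inverse of the cell-by-4-cycle block of the gap matrix. -/
noncomputable def gapInv (p q : Fin 3 × Fin 3) : ℝ :=
  (if p.1 = q.1 then -1 / 2 else 1 / 2) * if p.2 = q.2 then -1 / 2 else 1 / 2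

theorem sum_gapRel_mul_gapInv (p q : Fin 3 × Fin 3) :
    ∑ s, (if gapRel (.inl p) (.inl s) then 1 else 0) * gapInv s q = if p = q then 1 else 0 := by
  rw [Fintype.sum_prod_type]
  obtain ⟨i, j⟩ := p
  obtain ⟨a, b⟩ := q
  fin_cases i <;> fin_cases j <;> fin_cases a <;> fin_cases b <;>
    simp [gapInv, gapRel, Fin.sum_univ_three] <;> norm_num

theorem NNDecomp.nine_mul_le {q r : ℕ} (h : NNDecomp (gapMatrix q) r) : 9 * q ≤ r := by
  obtain ⟨u, v, -, -, huv⟩ := h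
  let P : Matrix (Fin q × (Fin 3 × Fin 3)) (Fin r) ℝ := fun x k => u k (x.1, .inl x.2)
  let Q : Matrix (Fin r) (Fin q × (Fin 3 × Fin 3)) ℝ := fun k y => v k (y.1, .inl y.2)
  let N : Matrix (Fin q × (Fin 3 × Fin 3)) (Fin q × (Fin 3 × Fin 3)) ℝ :=
    fun x y => if x.1 = y.1 then gapInv x.2 y.2 else 0
  have hPQ : P * (Q * N) = 1 := by
    rw [← Matrix.mul_assoc]
    ext ⟨b, p⟩ ⟨b', p'⟩
    have : ∀ y, (P * Q) (b, p) y = gapMatrix q (b, .inl p) (y.1, .inl y.2) := fun y => by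
      rw [huv]; rfl
    rw [Matrix.mul_apply, Fintype.sum_prod_type, Finset.sum_eq_single b]
    · by_cases hb : b = b'
      · subst hb
        simp [this, gapMatrix, N, Matrix.one_apply, ← sum_gapRel_mul_gapInv]
      · simp [N, hb]
    · intro b'' _ hb
      simp [this, gapMatrix, hb.symm]
    · simp
  have h1 := Matrix.rank_mul_le_left P (Q * N)
  have h2 := Matrix.rank_le_card_width P
  rw [hPQ, Matrix.rank_one] at h1
  rw [Fintype.card_fin] at h2
  simp at h1
  omega

theorem NNDecomp.submatrix {α β α' β' : Type*} {M : Matrix α β ℝ} {r : ℕ} (h : NNDecomp M r)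
    (f : α' → α) (g : β' → β) : NNDecomp (M.submatrix f g) r := by
  obtain ⟨u, v, hu, hv, huv⟩ := h
  exact ⟨fun k => u k ∘ f, fun k => v k ∘ g, fun k _ => hu k _, fun k _ => hv k _,
    fun i j => huv (f i) (g j)⟩

theorem BinDecomp.submatrix {α β α' β' : Type*} {M : Matrix α β ℝ} {r : ℕ} (h : BinDecomp M r)
    (f : α' → α) (g : β' → β) : BinDecomp (M.submatrix f g) r := by
  obtain ⟨u, v, hu, hv, huv⟩ := h
  exact ⟨fun k => u k ∘ f, fun k => v k ∘ g, fun k _ => hu k _, fun k _ => hv k _,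
    fun i j => huv (f i) (g j)⟩

/-- For every positive `k` divisible by 9 there is a total 0-1 matrix
with nonnegative rank `k` and binary rank `(4/3)·k`. -/
theorem four_thirds_gap (k : ℕ) (hk : 0 < k) (hdvd : 9 ∣ k) :
    ∃ (n m : ℕ) (M : Matrix (Fin n) (Fin m) ℝ), Is01 M ∧
      nnRank M = k ∧ 3 * binRank M = 4 * k := by
  obtain ⟨q, rfl⟩ := hdvd
  let e := (Fintype.equivFin (Fin q × GapRow)).symm
  let f := (Fintype.equivFin (Fin q × GapCol)).symm
  let M := (gapMatrix q).submatrix e f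
  have hback : M.submatrix e.symm f.symm = gapMatrix q := by
    simp [M, Matrix.submatrix_submatrix]
  have h01 : Is01 M := by
    intro i j
    simp only [M, Matrix.submatrix_apply, gapMatrix]
    split_ifs <;> simp
  have hcard : Fintype.card (Fin q × GapCol) = 12 * q := by simp [mul_comm]
  have hnn : nnRank M = 9 * q := by
    have hM := (nnDecomp_gapMatrix q).submatrix e f
    refine le_antisymm (Nat.sInf_le hM) (le_csInf ⟨_, hM⟩ fun r hr => ?_)
    exact NNDecomp.nine_mul_le (hback ▸ NNDecomp.submatrix hr e.symm f.symm)
  have hbin : binRank M = 12 * q := by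
    have hM : BinDecomp M (12 * q) := hcard ▸ binDecomp_of_is01 h01
    refine le_antisymm (Nat.sInf_le hM) (le_csInf ⟨_, hM⟩ fun r hr => ?_)
    exact BinDecomp.twelve_mul_le (hback ▸ BinDecomp.submatrix hr e.symm f.symm)
  exact ⟨_, _, M, h01, hnn, by rw [hbin]; ring⟩
end

section
/- For every total 0-1 matrix M, every decomposition M = M⁽¹⁾ + ⋯ + M⁽ʳ⁾ where each M⁽ⁱ⁾ is an entrywise-nonnegative real matrix of rank at most 1, with supports R₁,…,R_r, and every i ∈ {1,…,r}, the set R_i \ ∪_{j≠i} R_j is a rectangle. -/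
/-- A (combinatorial) rectangle: a set of positions of the form `A × B`. -/
def IsRectangle {α β : Type*} (R : Set (α × β)) : Prop :=
  ∃ (A : Set α) (B : Set β), R = A ×ˢ B

/-- A set of positions is a rectangle as soon as it is closed under exchanging coordinates. -/
theorem isRectangle_of_exchange {α β : Type*} {S : Set (α × β)}
    (h : ∀ a b a' b', (a, b) ∈ S → (a', b') ∈ S → (a, b') ∈ S) : IsRectangle S := by
  refine ⟨Prod.fst '' S, Prod.snd '' S, Set.Subset.antisymm ?_ ?_⟩
  · exact fun p hp => ⟨⟨p, hp, rfl⟩, ⟨p, hp, rfl⟩⟩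
  · rintro ⟨a, b'⟩ ⟨⟨⟨_, b⟩, hp, rfl⟩, ⟨⟨a', _⟩, hq, rfl⟩⟩
    exact h _ _ _ _ hp hq

/-- For every 0-1 matrix `M`, every `rank₊` decomposition of `M` into
nonnegative rank-at-most-1 matrices with supports `R 1, …, R r`, and every `i`,
the set `R i \ ⋃_{j ≠ i} R j` is a rectangle. -/
theorem leftover_rectangle {α β : Type*} [Fintype α] [Fintype β]
    (M : Matrix α β ℝ) (hM : Is01 M) (r : ℕ)
    (u : Fin r → α → ℝ) (v : Fin r → β → ℝ)
    (hu : ∀ k i, 0 ≤ u k i) (hv : ∀ k j, 0 ≤ v k j)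
    (hsum : ∀ i j, M i j = ∑ k, u k i * v k j)
    (R : Fin r → Set (α × β))
    (hR : ∀ k, R k = {p | u k p.1 * v k p.2 ≠ 0})
    (i : Fin r) :
    IsRectangle (R i \ ⋃ (j) (_ : j ≠ i), R j) := by
  have hnn : ∀ k a b, 0 ≤ u k a * v k b := fun k a b => mul_nonneg (hu k a) (hv k b)
  have hsplit : ∀ a b, M a b = u i a * v i b + ∑ k ∈ Finset.univ.erase i, u k a * v k b :=
    fun a b => by
      rw [hsum]
      exact (Finset.add_sum_erase _ (fun k => u k a * v k b) (Finset.mem_univ i)).symm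
  have hrest : ∀ a b, 0 ≤ ∑ k ∈ Finset.univ.erase i, u k a * v k b :=
    fun a b => Finset.sum_nonneg fun k _ => hnn k a b
  have hle : ∀ a b, u i a * v i b ≤ 1 := fun a b => by
    rcases hM a b with h | h <;> linarith [hsplit a b, hrest a b]
  have hmem : ∀ a b, (a, b) ∈ R i \ ⋃ (j) (_ : j ≠ i), R j ↔ u i a * v i b = 1 := by
    intro a b
    simp only [hR, Set.mem_sdiff, Set.mem_iUnion, Set.mem_ofPred_eq, not_exists, not_not]
    constructor
    · rintro ⟨hne, hz⟩
      have hzero : ∑ k ∈ Finset.univ.erase i, u k a * v k b = 0 :=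
        Finset.sum_eq_zero fun k hk => hz k (Finset.ne_of_mem_erase hk)
      have hMab := hsplit a b
      rw [hzero, add_zero] at hMab
      rw [← hMab] at hne ⊢
      exact (hM a b).resolve_left hne
    · intro h1
      refine ⟨by rw [h1]; exact one_ne_zero, fun k hk => ?_⟩
      have hzero : ∑ k ∈ Finset.univ.erase i, u k a * v k b = 0 := by
        rcases hM a b with h | h <;> linarith [hsplit a b, hrest a b]
      exact (Finset.sum_eq_zero_iff_of_nonneg fun k _ => hnn k a b).1 hzero k
        (Finset.mem_erase.2 ⟨hk, Finset.mem_univ k⟩)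
  refine isRectangle_of_exchange fun a b a' b' h h' => ?_
  rw [hmem] at h h' ⊢
  have hprod : (u i a * v i b') * (u i a' * v i b) = 1 := by
    calc (u i a * v i b') * (u i a' * v i b)
        = (u i a * v i b) * (u i a' * v i b') := by ring
      _ = 1 := by rw [h, h', one_mul]
  refine le_antisymm (hle a b') ?_
  rw [← hprod]
  exact mul_le_of_le_one_right (hnn i a b') (hle a' b)
end

section
/- Let M₅ be the 5×6 total 0-1 matrix with rows (1,1,1,0,0,0), (1,0,0,1,1,0), (0,1,0,1,0,1), (0,0,1,0,1,1), (1,1,1,1,1,1). For every integer k ≥ 1, rank₊(M₅^{⊗k}) = fool(M₅^{⊗k}) = 4^k, where M₅^{⊗k} is the k-fold Kronecker tensor product of M₅ with itself. -/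
/-- A fooling set of `M`: a set of positions of 1-entries such that for any two distinct
positions `(a,b)` and `(c,d)` in it, `M a d = 0` or `M c b = 0`. -/
def IsFoolingSet {α β : Type*} (M : Matrix α β ℝ) (S : Finset (α × β)) : Prop :=
  (∀ p ∈ S, M p.1 p.2 = 1) ∧
  ∀ p ∈ S, ∀ q ∈ S, p ≠ q → M p.1 q.2 = 0 ∨ M q.1 p.2 = 0

/-- `fool M` is the maximum size of a fooling set of `M`. -/
noncomputable def fool {α β : Type*} (M : Matrix α β ℝ) : ℕ :=
  sSup {s | ∃ S : Finset (α × β), IsFoolingSet M S ∧ S.card = s}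

/-- The 5×6 matrix from Theorem 2(2). -/
def M5 : Matrix (Fin 5) (Fin 6) ℝ :=
  !![1,1,1,0,0,0;
     1,0,0,1,1,0;
     0,1,0,1,0,1;
     0,0,1,0,1,1;
     1,1,1,1,1,1]

/-- The `k`-fold Kronecker tensor power of `M`, with rows indexed by `k`-tuples of row
indices and columns by `k`-tuples of column indices. -/
def kronPow {n m : ℕ} (M : Matrix (Fin n) (Fin m) ℝ) (k : ℕ) :
    Matrix (Fin k → Fin n) (Fin k → Fin m) ℝ :=
  Matrix.of fun x y => ∏ i, M (x i) (y i)

/-- The size of a fooling set is at most the number of summands of any nonnegative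
decomposition: distinct positions are covered by distinct summands. -/
theorem IsFoolingSet.card_le {α β : Type*} {M : Matrix α β ℝ} {S : Finset (α × β)}
    (hS : IsFoolingSet M S) {r : ℕ} (h : NNDecomp M r) : S.card ≤ r := by
  obtain ⟨u, v, hu, hv, hM⟩ := h
  have hcover : ∀ p : S, ∃ k, u k p.1.1 * v k p.1.2 ≠ 0 := by
    intro p
    by_contra! hzero
    have h1 := hS.1 p p.2
    rw [hM, Finset.sum_eq_zero fun k _ => hzero k] at h1
    exact zero_ne_one h1
  have hvanish : ∀ a b, M a b = 0 → ∀ k, u k a * v k b = 0 := by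
    intro a b hab k
    rw [hM, Finset.sum_eq_zero_iff_of_nonneg fun k _ => mul_nonneg (hu k a) (hv k b)] at hab
    exact hab k (Finset.mem_univ k)
  choose f hf using hcover
  have hinj : Function.Injective f := by
    intro p q hpq
    by_contra hne
    have hfp := mul_ne_zero_iff.1 (hf p)
    have hfq := mul_ne_zero_iff.1 (hf q)
    rw [← hpq] at hfq
    rcases hS.2 p p.2 q q.2 (Subtype.coe_injective.ne hne) with h0 | h0
    · exact mul_ne_zero hfp.1 hfq.2 (hvanish _ _ h0 (f p))
    · exact mul_ne_zero hfq.1 hfp.2 (hvanish _ _ h0 (f p))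
  simpa using Fintype.card_le_of_injective f hinj

/-- Nonnegative decompositions multiply under tensor powers. -/
theorem NNDecomp.kronPow {n m r : ℕ} {M : Matrix (Fin n) (Fin m) ℝ} (h : NNDecomp M r) (k : ℕ) :
    NNDecomp (kronPow M k) (r ^ k) := by
  obtain ⟨u, v, hu, hv, hM⟩ := h
  refine ⟨fun t x => ∏ i, u (finFunctionFinEquiv.symm t i) (x i),
    fun t y => ∏ i, v (finFunctionFinEquiv.symm t i) (y i),
    fun t x => Finset.prod_nonneg fun i _ => hu _ _,
    fun t y => Finset.prod_nonneg fun i _ => hv _ _, fun x y => ?_⟩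
  rw [Equiv.sum_comp finFunctionFinEquiv.symm
    (fun s : Fin k → Fin r => (∏ i, u (s i) (x i)) * ∏ i, v (s i) (y i))]
  simp only [_root_.kronPow, Matrix.of_apply, hM, ← Finset.prod_mul_distrib]
  rw [Finset.prod_univ_sum, Fintype.piFinset_univ]

/-- The pointwise power of a fooling set, given as a family of positions, is a fooling set
of the tensor power. -/
theorem exists_isFoolingSet_kronPow {n m r : ℕ} {M : Matrix (Fin n) (Fin m) ℝ}
    (a : Fin r → Fin n) (b : Fin r → Fin m) (hone : ∀ i, M (a i) (b i) = 1)
    (hzero : ∀ i j, i ≠ j → M (a i) (b j) = 0 ∨ M (a j) (b i) = 0)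
    (ha : Function.Injective a) (k : ℕ) :
    ∃ S, IsFoolingSet (kronPow M k) S ∧ S.card = r ^ k := by
  refine ⟨Finset.univ.image fun s : Fin k → Fin r => (a ∘ s, b ∘ s), ⟨?_, ?_⟩, ?_⟩
  · simp [kronPow, hone]
  · simp only [Finset.mem_image, Finset.mem_univ, true_and]
    rintro _ ⟨s, rfl⟩ _ ⟨t, rfl⟩ hne
    obtain ⟨i, hi⟩ : ∃ i, s i ≠ t i := by
      by_contra! hst
      exact hne (by rw [funext hst])
    exact (hzero _ _ hi).imp (Finset.prod_eq_zero (Finset.mem_univ i))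
      (Finset.prod_eq_zero (Finset.mem_univ i))
  · rw [Finset.card_image_of_injective]
    · simp
    · intro s t hst
      exact ha.comp_left (congrArg Prod.fst hst)

/-- The last row of `M5` is half the sum of the other four. -/
theorem nnDecomp_M5 : NNDecomp M5 4 := by
  refine ⟨fun l i => if i = Fin.last 4 then 1 / 2 else if i = l.castSucc then 1 else 0,
    fun l j => M5 l.castSucc j, ?_, ?_, ?_⟩
  · intro l i
    dsimp only
    split_ifs <;> norm_num
  · intro l j
    fin_cases l <;> fin_cases j <;> simp [M5]
  · have h2 (j) : M5 (Fin.castSucc 2) j = ![0, 1, 0, 1, 0, 1] j := rfl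
    have h3 (j) : M5 (Fin.castSucc 3) j = ![0, 0, 1, 0, 1, 1] j := rfl
    intro i j
    simp only [Fin.sum_univ_four, h2, h3]
    fin_cases i <;> fin_cases j <;> norm_num [M5, Fin.ext_iff]

/-- `M5` has a fooling set of size `4`, given by a cyclic choice of columns. -/
theorem exists_isFoolingSet_kronPow_M5 (k : ℕ) :
    ∃ S, IsFoolingSet (kronPow M5 k) S ∧ S.card = 4 ^ k := by
  refine exists_isFoolingSet_kronPow Fin.castSucc ![0, 3, 5, 2] ?_ ?_
    (Fin.castSucc_injective 4) k
  · intro i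
    fin_cases i <;> simp [M5]
  · intro i j hij
    fin_cases i <;> fin_cases j <;> simp [M5] at hij ⊢

/-- For every `k ≥ 1`, `rank₊(M5^{⊗k}) = fool(M5^{⊗k}) = 4^k`. -/
theorem nnRank_fool_kronPow_M5 (k : ℕ) (hk : 1 ≤ k) :
    nnRank (kronPow M5 k) = 4 ^ k ∧ fool (kronPow M5 k) = 4 ^ k := by
  have hdecomp := nnDecomp_M5.kronPow k
  obtain ⟨S, hS, hcard⟩ := exists_isFoolingSet_kronPow_M5 k
  constructor
  · refine IsLeast.csInf_eq ⟨hdecomp, fun r hr => ?_⟩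
    exact hcard ▸ hS.card_le hr
  · refine IsGreatest.csSup_eq ⟨⟨S, hS, hcard⟩, ?_⟩
    rintro _ ⟨T, hT, rfl⟩
    exact hT.card_le hdecomp
end

section
/- Let A be the 4×4 total 0-1 matrix with rows (1,1,0,1), (1,0,1,1), (0,1,1,1), (1,1,1,1). Then rank₀₁(A) = 4, yet the three rectangles R₁ = {1,4}×{1,2,4}, R₂ = {2,4}×{1,3,4}, R₃ = {3,4}×{2,3,4} form a cover of the 1-entries of A by rectangles consisting only of 1-entries, and for each i ∈ {1,2,3} the set R_i \ ∪_{j≠i} R_j is a rectangle. -/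
/-- The 4×4 matrix from the first example in Section 3.3 (rows and columns 0-indexed). -/
def A4 : Matrix (Fin 4) (Fin 4) ℝ :=
  !![1,1,0,1;
     1,0,1,1;
     0,1,1,1;
     1,1,1,1]

/-- The rectangle `{1,4} × {1,2,4}` (0-indexed: `{0,3} × {0,1,3}`). -/
def Q1 : Set (Fin 4 × Fin 4) := ({0, 3} : Set (Fin 4)) ×ˢ ({0, 1, 3} : Set (Fin 4))

/-- The rectangle `{2,4} × {1,3,4}` (0-indexed: `{1,3} × {0,2,3}`). -/
def Q2 : Set (Fin 4 × Fin 4) := ({1, 3} : Set (Fin 4)) ×ˢ ({0, 2, 3} : Set (Fin 4))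

/-- The rectangle `{3,4} × {2,3,4}` (0-indexed: `{2,3} × {1,2,3}`). -/
def Q3 : Set (Fin 4 × Fin 4) := ({2, 3} : Set (Fin 4)) ×ˢ ({1, 2, 3} : Set (Fin 4))

/-- Any binary decomposition of `M` has at least `M.rank` summands. -/
theorem BinDecomp.rank_le {α β : Type*} [Fintype β] {M : Matrix α β ℝ} {r : ℕ}
    (h : BinDecomp M r) : M.rank ≤ r := by
  obtain ⟨u, v, -, -, h⟩ := h
  have hM : M = (Matrix.of u).transpose * Matrix.of v := by
    ext i j
    simp [Matrix.mul_apply, h]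
  calc M.rank ≤ (Matrix.of u).transpose.rank := hM ▸ Matrix.rank_mul_le_left _ _
    _ ≤ r := by simpa using Matrix.rank_le_card_width (Matrix.of u).transpose

/-- A 0-1 matrix with `n` rows is the sum of its rows. -/
theorem Is01.binDecomp {n : ℕ} {β : Type*} {M : Matrix (Fin n) β ℝ} (h : Is01 M) :
    BinDecomp M n :=
  ⟨fun k i => if i = k then 1 else 0, M, fun k i => (ite_eq_or_eq _ _ _).symm, h,
    fun i j => by simp⟩

theorem is01_A4 : Is01 A4 := by
  intro i j
  fin_cases i <;> fin_cases j <;> simp [A4]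

theorem det_A4 : A4.det = 1 := by
  simp [A4, Matrix.det_succ_row_zero, Fin.sum_univ_succ, Fin.succAbove]
  norm_num

theorem rank_A4 : A4.rank = 4 := by
  have h : IsUnit A4 := (Matrix.isUnit_iff_isUnit_det A4).2 (by simp [det_A4])
  simpa using Matrix.rank_of_isUnit A4 h

/-- `rank₀₁(A4) = 4`, yet `Q1, Q2, Q3` form a 1's cover of `A4` by
rectangles consisting only of 1-entries, and each `Q i \ ∪_{j ≠ i} Q j` is a rectangle. -/
theorem A4_example :
    binRank A4 = 4 ∧
    (∀ p ∈ Q1 ∪ Q2 ∪ Q3, A4 p.1 p.2 = 1) ∧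
    (∀ i j, A4 i j = 1 → (i, j) ∈ Q1 ∪ Q2 ∪ Q3) ∧
    IsRectangle (Q1 \ (Q2 ∪ Q3)) ∧
    IsRectangle (Q2 \ (Q1 ∪ Q3)) ∧
    IsRectangle (Q3 \ (Q1 ∪ Q2)) := by
  refine ⟨le_antisymm (Nat.sInf_le is01_A4.binDecomp)
    (le_csInf ⟨4, is01_A4.binDecomp⟩ fun r hr => rank_A4 ▸ BinDecomp.rank_le hr), ?_, ?_,
    ⟨{0}, {0, 1, 3}, ?_⟩, ⟨{1}, {0, 2, 3}, ?_⟩, ⟨{2}, {1, 2, 3}, ?_⟩⟩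
  · rintro ⟨i, j⟩
    fin_cases i <;> fin_cases j <;> simp [A4, Q1, Q2, Q3]
  · intro i j
    fin_cases i <;> fin_cases j <;> simp [A4, Q1, Q2, Q3]
  all_goals
    ext ⟨i, j⟩
    fin_cases i <;> fin_cases j <;> simp [Q1, Q2, Q3]
end
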